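/- There exists η > 0 such that for every admissible function V there is a constant C > 0 with the following property: for every prime q and every integer ξ coprime to q, |q^{-1/2} · Σ_{n ≥ 1, gcd(n,q)=1} d(n) · n^{-1/2} · V(n/q) · e^{2πi ξ n² / q}| ≤ C · q^{-η}, where d(n) denotes the number of divisors of n. -/

import Mathlib

open scoped Real

/-- A smooth function `V` on `(0,∞)` is admissible if `V(y) = 1 + O(y^A)` near `0`,
`V(y) ≪ y^{-A}` for `y ≥ 1`, and `y^j V^{(j)}(y) ≪ y^{-A}` for all `j ≥ 1` and all `A > 1`. -/
def Admissible (V : ℝ → ℂ) : Prop :=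
  ContDiffOn ℝ (⊤ : ℕ∞) V (Set.Ioi 0) ∧
  (∀ A : ℝ, 1 < A → ∃ C : ℝ, ∀ y : ℝ, 0 < y → ‖V y - 1‖ ≤ C * y ^ A) ∧
  (∀ A : ℝ, 1 < A → ∃ C : ℝ, ∀ y : ℝ, 1 ≤ y → ‖V y‖ ≤ C * y ^ (-A)) ∧
  (∀ j : ℕ, 1 ≤ j → ∀ A : ℝ, 1 < A → ∃ C : ℝ, ∀ y : ℝ, 0 < y →
    y ^ j * ‖iteratedDerivWithin j V (Set.Ioi 0) y‖ ≤ C * y ^ (-A))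

/-- The additive character `x ↦ exp(2πix)` of `ℝ`. -/
noncomputable def unitExp (x : ℝ) : ℂ := Complex.exp ((2 * π * x : ℝ) * Complex.I)

lemma norm_unitExp (x : ℝ) : ‖unitExp x‖ = 1 := Complex.norm_exp_ofReal_mul_I _

lemma unitExp_add (x y : ℝ) : unitExp (x + y) = unitExp x * unitExp y := by
  rw [unitExp, unitExp, unitExp, ← Complex.exp_add]
  congr 1
  push_cast
  ring

lemma unitExp_nat_mul (n : ℕ) (x : ℝ) : unitExp (n * x) = unitExp x ^ n := by
  rw [unitExp, unitExp, ← Complex.exp_nat_mul]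
  congr 1
  push_cast
  ring

lemma conj_unitExp (x : ℝ) : (starRingEnd ℂ) (unitExp x) = unitExp (-x) := by
  rw [unitExp, unitExp, ← Complex.exp_conj, map_mul, Complex.conj_ofReal, Complex.conj_I]
  congr 1
  push_cast
  ring

/-- The distance from a real number to the nearest integer. -/
noncomputable def distInt (x : ℝ) : ℝ := |x - round x|

lemma distInt_le (x : ℝ) (m : ℤ) : distInt x ≤ |x - m| := round_le x m

lemma four_mul_distInt_le (x : ℝ) : 4 * distInt x ≤ ‖unitExp x - 1‖ := by
  have h1 : unitExp x = Complex.exp (Complex.I * ((2 * π * (x - round x) : ℝ) : ℂ)) := by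
    rw [unitExp, Complex.exp_eq_exp_iff_exists_int]
    refine ⟨round x, ?_⟩
    push_cast
    ring
  have h2 : |x - round x| ≤ 1 / 2 := abs_sub_round x
  rw [h1, Complex.norm_exp_I_mul_ofReal_sub_one, distInt, Real.norm_eq_abs, abs_mul,
    show 2 * π * (x - round x) / 2 = π * (x - round x) by ring]
  have h3 : |Real.sin (π * (x - round x))| = |Real.sin (π * |x - round x|)| := by
    rcases abs_cases (x - round x) with ⟨h, -⟩ | ⟨h, -⟩ <;> rw [h]
    rw [mul_neg, Real.sin_neg, abs_neg]
  rw [h3]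
  have h4 := Real.mul_le_sin (x := π * |x - round x|) (by positivity)
    (by nlinarith [Real.pi_pos])
  have h5 : 2 / π * (π * |x - round x|) = 2 * |x - round x| := by
    field_simp
  rw [h5] at h4
  have := le_abs_self (Real.sin (π * |x - round x|))
  rw [abs_two]
  linarith

lemma norm_geom_sum_unitExp_mul_le (x : ℝ) (n : ℕ) :
    ‖∑ k ∈ Finset.range n, unitExp x ^ k‖ * (2 * distInt x) ≤ 1 := by
  have h1 := four_mul_distInt_le x
  have h2 : ‖∑ k ∈ Finset.range n, unitExp x ^ k‖ * ‖unitExp x - 1‖ ≤ 2 := by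
    rw [← norm_mul, geom_sum_mul]
    refine (norm_sub_le _ _).trans ?_
    rw [norm_pow, norm_unitExp]
    norm_num
  have h3 := mul_le_mul_of_nonneg_left h1
    (norm_nonneg (∑ k ∈ Finset.range n, unitExp x ^ k))
  linarith

/-- Weyl differencing: the squared modulus of a sum in terms of its autocorrelations. -/
lemma sum_range_mul_conj (f : ℕ → ℂ) (n : ℕ) :
    ‖∑ k ∈ Finset.range n, f k‖ ^ 2 = ∑ k ∈ Finset.range n, ‖f k‖ ^ 2 +
      2 * (∑ h ∈ Finset.range n, ∑ k ∈ Finset.range (n - (h + 1)),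
        f (k + (h + 1)) * (starRingEnd ℂ) (f k)).re := by
  induction n with
  | zero => simp
  | succ n ih =>
    have h1 : ∑ h ∈ Finset.range (n + 1), ∑ k ∈ Finset.range (n + 1 - (h + 1)),
        f (k + (h + 1)) * (starRingEnd ℂ) (f k) =
        ∑ h ∈ Finset.range n, ∑ k ∈ Finset.range (n - (h + 1)),
          f (k + (h + 1)) * (starRingEnd ℂ) (f k) +
        f n * (starRingEnd ℂ) (∑ k ∈ Finset.range n, f k) := by
      rw [Finset.sum_range_succ, map_sum, Finset.mul_sum, ← Finset.sum_range_reflect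
        (fun k => f n * (starRingEnd ℂ) (f k)), ← Finset.sum_add_distrib]
      simp only [Nat.sub_self, Finset.range_zero, Finset.sum_empty, add_zero]
      refine Finset.sum_congr rfl fun h hh => ?_
      have hh' := Finset.mem_range.1 hh
      rw [show n + 1 - (h + 1) = (n - (h + 1)) + 1 by omega, Finset.sum_range_succ,
        show n - (h + 1) + (h + 1) = n by omega, show n - 1 - h = n - (h + 1) by omega]
    rw [h1, Finset.sum_range_succ, Finset.sum_range_succ, Complex.add_re, mul_add, ← add_assoc,
      add_right_comm (∑ k ∈ Finset.range n, ‖f k‖ ^ 2), ← ih]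
    simp only [← Complex.normSq_eq_norm_sq, Complex.normSq_add]
    rw [← Complex.conj_re (f n * _), map_mul, Complex.conj_conj, mul_comm (starRingEnd ℂ (f n))]

/-- Bound for a quadratic Weyl sum by the number of small multiples of twice the leading
coefficient. -/
lemma norm_quadratic_sum_sq_le (θ Δ : ℝ) (hΔ : 0 < Δ) (c n A : ℕ) (hn : n ≤ A) :
    ‖∑ k ∈ Finset.range n, unitExp (θ * ((c + k : ℕ) : ℝ) ^ 2)‖ ^ 2 ≤
      A + 2 * (A * ((Finset.Icc 1 A).filter fun h : ℕ => distInt (2 * θ * h) < Δ).card +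
        A / (2 * Δ)) := by
  have hterm : ∀ h : ℕ, ‖∑ k ∈ Finset.range (n - h),
      unitExp (θ * ((c + (k + h) : ℕ) : ℝ) ^ 2) *
        (starRingEnd ℂ) (unitExp (θ * ((c + k : ℕ) : ℝ) ^ 2))‖ =
      ‖∑ k ∈ Finset.range (n - h), unitExp (2 * θ * h) ^ k‖ := by
    intro h
    have : ∀ k : ℕ, unitExp (θ * ((c + (k + h) : ℕ) : ℝ) ^ 2) *
        (starRingEnd ℂ) (unitExp (θ * ((c + k : ℕ) : ℝ) ^ 2)) =
        unitExp (θ * (h ^ 2 + 2 * h * c)) * unitExp (2 * θ * h) ^ k := by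
      intro k
      rw [conj_unitExp, ← unitExp_nat_mul, ← unitExp_add, ← unitExp_add]
      congr 1
      push_cast
      ring
    simp_rw [this]
    rw [← Finset.mul_sum, norm_mul, norm_unitExp, one_mul]
  have hb : ∀ h : ℕ, ‖∑ k ∈ Finset.range (n - h), unitExp (2 * θ * h) ^ k‖ ≤
      (if distInt (2 * θ * h) < Δ then (A : ℝ) else 0) + 1 / (2 * Δ) := by
    intro h
    split_ifs with hh
    · have : ‖∑ k ∈ Finset.range (n - h), unitExp (2 * θ * h) ^ k‖ ≤ (n - h : ℕ) := by
        refine (norm_sum_le _ _).trans ?_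
        simp [norm_unitExp]
      have h2 : ((n - h : ℕ) : ℝ) ≤ A := by exact_mod_cast (Nat.sub_le n h).trans hn
      have : 0 < 1 / (2 * Δ) := by positivity
      linarith
    · rw [zero_add, le_div_iff₀ (by positivity)]
      refine le_trans ?_ (norm_geom_sum_unitExp_mul_le (2 * θ * h) (n - h))
      gcongr
      exact not_lt.1 hh
  rw [sum_range_mul_conj]
  have h1 : ∑ k ∈ Finset.range n, ‖unitExp (θ * ((c + k : ℕ) : ℝ) ^ 2)‖ ^ 2 ≤ A := by
    simp only [norm_unitExp]
    simpa using hn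
  refine add_le_add h1 (mul_le_mul_of_nonneg_left ?_ zero_le_two)
  refine (Complex.re_le_norm _).trans ((norm_sum_le _ _).trans ?_)
  have h2 : ∑ h ∈ Finset.range n, ‖∑ k ∈ Finset.range (n - (h + 1)),
      unitExp (θ * ((c + (k + (h + 1)) : ℕ) : ℝ) ^ 2) *
        (starRingEnd ℂ) (unitExp (θ * ((c + k : ℕ) : ℝ) ^ 2))‖ ≤
      ∑ h ∈ Finset.range A, ((if distInt (2 * θ * (h + 1 : ℕ)) < Δ then (A : ℝ) else 0) +
        1 / (2 * Δ)) := by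
    refine (Finset.sum_le_sum fun h _ => ?_).trans
      (Finset.sum_le_sum_of_subset_of_nonneg (Finset.range_subset_range.2 hn) fun h _ _ => ?_)
    · rw [hterm]
      exact hb _
    · have : 0 ≤ 1 / (2 * Δ) := by positivity
      split_ifs <;> positivity
  refine h2.trans (le_of_eq ?_)
  rw [Finset.sum_add_distrib, Finset.range_eq_Ico,
    Finset.sum_Ico_add' (fun h : ℕ => if distInt (2 * θ * h) < Δ then (A : ℝ) else 0) 0 A 1,
    ← Finset.sum_filter]
  have : Finset.Ico (0 + 1) (A + 1) = Finset.Icc 1 A := by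
    ext; simp [Nat.succ_le_iff]
  rw [this]
  simp
  ring

/-- Multiples of a real number whose small multiples are well spaced modulo one are
well distributed modulo one. -/
lemma card_distInt_lt_le (α Δ : ℝ) (hΔ : 0 < Δ) (s A : ℕ) (hs : 0 < s)
    (hsp : ∀ h : ℕ, 0 < h → 2 * h ≤ s → 1 / (2 * s : ℝ) ≤ distInt (α * h)) :
    (((Finset.Icc 1 A).filter fun h : ℕ => distInt (α * h) < Δ).card : ℝ) ≤
      (2 * A / s + 1) * (4 * s * Δ + 1) := by
  have hs' : (0 : ℝ) < s := by exact_mod_cast hs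
  set L := s / 2 + 1 with hL
  set v : ℕ → ℝ := fun h => α * h - round (α * h) with hv
  have hsep : ∀ h h' : ℕ, distInt (α * h) < Δ → distInt (α * h') < Δ → h < h' →
      h / L = h' / L → ⌊(v h + Δ) * (2 * s)⌋₊ = ⌊(v h' + Δ) * (2 * s)⌋₊ → False := by
    intro h h' hd hd' hlt hq hf
    have h0 : h' - h ≤ s / 2 := by
      have e1 := Nat.div_add_mod h L
      have e2 := Nat.div_add_mod h' L
      have e3 := Nat.mod_lt h' (show 0 < L by omega)
      rw [hq] at e1
      omega
    have h1 := hsp (h' - h) (by omega) (by omega)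
    have h2 : distInt (α * (h' - h : ℕ)) ≤ |v h' - v h| := by
      have := distInt_le (α * (h' - h : ℕ)) (round (α * h') - round (α * h))
      rw [Nat.cast_sub hlt.le] at this ⊢
      refine this.trans (le_of_eq ?_)
      congr 1
      simp only [hv]
      push_cast
      ring
    have p1 : 0 ≤ (v h + Δ) * (2 * s) := by
      have := abs_lt.1 hd
      exact mul_nonneg (by simp only [hv]; linarith) (by positivity)
    have p2 : 0 ≤ (v h' + Δ) * (2 * s) := by
      have := abs_lt.1 hd'
      exact mul_nonneg (by simp only [hv]; linarith) (by positivity)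
    have a1 := Nat.floor_le p1
    have a2 := Nat.lt_floor_add_one ((v h + Δ) * (2 * s))
    have b1 := Nat.floor_le p2
    have b2 := Nat.lt_floor_add_one ((v h' + Δ) * (2 * s))
    rw [hf] at a1 a2
    have h3 : |v h' - v h| * (2 * s) < 1 := by
      rw [← abs_of_pos (show (0 : ℝ) < 2 * s by positivity), ← abs_mul, abs_lt]
      constructor <;> nlinarith
    have h4 := h1.trans h2
    rw [div_le_iff₀ (by positivity)] at h4
    linarith
  have hcard : ((Finset.Icc 1 A).filter fun h : ℕ => distInt (α * h) < Δ).card ≤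
      (Finset.range (A / L + 1) ×ˢ Finset.range (⌊4 * s * Δ⌋₊ + 1)).card := by
    refine Finset.card_le_card_of_injOn (fun h => (h / L, ⌊(v h + Δ) * (2 * s)⌋₊)) ?_ ?_
    · intro h hh
      simp only [Finset.coe_filter, Finset.mem_Icc, Set.mem_ofPred_eq] at hh
      simp only [Finset.coe_product, Set.mem_prod, Finset.coe_range, Set.mem_Iio]
      refine ⟨Nat.lt_succ_of_le (Nat.div_le_div_right hh.1.2),
        Nat.lt_succ_of_le (Nat.floor_le_floor ?_)⟩
      have := abs_lt.1 hh.2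
      simp only [hv]
      nlinarith
    · intro h hh h' hh' heq
      simp only [Finset.coe_filter, Finset.mem_Icc, Set.mem_ofPred_eq] at hh hh'
      simp only [Prod.mk.injEq] at heq
      rcases lt_trichotomy h h' with hlt | hlt | hlt
      · exact (hsep h h' hh.2 hh'.2 hlt heq.1 heq.2).elim
      · exact hlt
      · exact (hsep h' h hh'.2 hh.2 hlt heq.1.symm heq.2.symm).elim
  rw [Finset.card_product, Finset.card_range, Finset.card_range] at hcard
  have hcard' : (((Finset.Icc 1 A).filter fun h : ℕ => distInt (α * h) < Δ).card : ℝ) ≤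
      ((A / L : ℕ) + 1) * (⌊4 * s * Δ⌋₊ + 1) := by exact_mod_cast hcard
  refine hcard'.trans ?_
  have h1 : ((A / L : ℕ) : ℝ) ≤ 2 * A / s := by
    refine Nat.cast_div_le.trans ?_
    have hL' : (s : ℝ) ≤ 2 * L := by
      have : s ≤ 2 * L := by omega
      exact_mod_cast this
    rw [div_le_div_iff₀ (by positivity) hs']
    nlinarith [(Nat.cast_nonneg A : (0 : ℝ) ≤ A)]
  have h2 : (⌊4 * s * Δ⌋₊ : ℝ) ≤ 4 * s * Δ := Nat.floor_le (by positivity)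
  gcongr

lemma le_distInt_mul_of_rat_approx (α : ℝ) (r : ℤ) (s : ℕ) (hs : 0 < s)
    (hrs : IsCoprime r (s : ℤ)) (happ : |α - r / s| ≤ 1 / (s : ℝ) ^ 2) (h : ℕ) (h0 : 0 < h)
    (h2 : 2 * h ≤ s) : 1 / (2 * s : ℝ) ≤ distInt (α * h) := by
  have hs' : (0 : ℝ) < s := by exact_mod_cast hs
  set m := round (α * h) with hm
  have hne : r * h - m * s ≠ 0 := by
    intro he
    have hd : (s : ℤ) ∣ r * h := ⟨m, by linarith⟩
    have hd2 : (s : ℤ) ∣ h := hrs.symm.dvd_of_dvd_mul_left hd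
    have := Nat.le_of_dvd h0 (Int.natCast_dvd_natCast.1 hd2)
    omega
  have h1 : (1 : ℝ) ≤ |(r * h - m * s : ℝ)| := by
    have := Int.one_le_abs hne
    exact_mod_cast this
  have h3 : |(r * h - m * s : ℝ)| = |(r / s : ℝ) * h - m| * s := by
    rw [← abs_of_pos hs', ← abs_mul, abs_of_pos hs']
    congr 1
    field_simp
  have h4 : |(α - r / s) * h| ≤ 1 / (2 * s) := by
    rw [abs_mul, Nat.abs_cast]
    have : (2 * h : ℝ) ≤ s := by exact_mod_cast h2
    calc |α - r / s| * h ≤ 1 / (s : ℝ) ^ 2 * (s / 2) := by gcongr; linarith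
      _ = 1 / (2 * s) := by field_simp
  have h5 : 1 / (s : ℝ) ≤ |(r / s : ℝ) * h - m| := by
    rw [div_le_iff₀ hs', ← h3]
    exact h1
  have h6 : |(r / s : ℝ) * h - m| ≤ |α * h - m| + |(α - r / s) * h| := by
    have := abs_sub (α * h - m) ((α - r / s) * h)
    refine le_trans (le_of_eq ?_) this
    congr 1
    ring
  have h7 : 1 / (s : ℝ) = 1 / (2 * s) + 1 / (2 * s) := by field_simp; norm_num
  change _ ≤ |α * h - m|
  linarith

lemma norm_quadratic_sum_sq_le_of_rat_approx (θ H : ℝ) (hH : 1 ≤ H) (r : ℤ) (s : ℕ)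
    (hs : 0 < s) (hrs : IsCoprime r (s : ℤ)) (happ : |2 * θ - r / s| ≤ 1 / (s : ℝ) ^ 2)
    (c n A : ℕ) (hn : n ≤ A) :
    ‖∑ k ∈ Finset.range n, unitExp (θ * ((c + k : ℕ) : ℝ) ^ 2)‖ ^ 2 ≤
      19 * A * H + 4 * A ^ 2 / s + 8 * s * H + A ^ 2 / H := by
  have hs' : (0 : ℝ) < s := by exact_mod_cast hs
  rcases Nat.eq_zero_or_pos A with rfl | hA
  · obtain rfl : n = 0 := by omega
    simp
    positivity
  have hA' : (0 : ℝ) < A := by exact_mod_cast hA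
  have h1 := norm_quadratic_sum_sq_le θ (H / A) (by positivity) c n A hn
  have h2 := card_distInt_lt_le (2 * θ) (H / A) (by positivity) s A hs
    (le_distInt_mul_of_rat_approx (2 * θ) r s hs hrs happ)
  have h3 : (A : ℝ) * ((Finset.Icc 1 A).filter fun h : ℕ => distInt (2 * θ * h) < H / A).card ≤
      A * ((2 * A / s + 1) * (4 * s * (H / A) + 1)) := by gcongr
  have h4 : (A : ℝ) * ((2 * A / s + 1) * (4 * s * (H / A) + 1)) =
      8 * A * H + 2 * A ^ 2 / s + 4 * s * H + A := by
    field_simp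
    ring
  have h5 : (A : ℝ) / (2 * (H / A)) = A ^ 2 / H / 2 := by
    field_simp
  rw [h5] at h1
  have h6 : (4 : ℝ) * A ^ 2 / s = 2 * (2 * A ^ 2 / s) := by ring
  rw [h6]
  nlinarith

lemma two_mul_mul_sq_isCoprime {q : ℕ} (hq : q.Prime) (hq2 : 2 < q) {ξ : ℤ}
    (hξ : Int.gcd ξ q = 1) {b : ℕ} (hb0 : 0 < b) (hbq : b < q) :
    IsCoprime (2 * ξ * (b : ℤ) ^ 2) (q : ℤ) := by
  refine IsCoprime.mul_left (IsCoprime.mul_left ?_ (Int.isCoprime_iff_gcd_eq_one.2 hξ))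
    (IsCoprime.pow_left ?_)
  · exact Nat.isCoprime_iff_coprime.2
      ((Nat.coprime_primes Nat.prime_two hq).2 (by omega))
  · exact Nat.isCoprime_iff_coprime.2 (Nat.coprime_of_lt_prime hb0.ne' hbq hq).symm

lemma norm_quadratic_sum_le_of_prime {q M : ℕ} (hM : 2 ≤ M) (hMq : M ^ 40 ≤ q)
    (hq : q.Prime) {ξ : ℤ}
    (hξ : Int.gcd ξ q = 1) {b : ℕ} (hb0 : 0 < b) (hbq : b < q) (c n A : ℕ) (hn : n ≤ A)
    (hA : A ≤ q * M) :
    ‖∑ k ∈ Finset.range n, unitExp (ξ * b ^ 2 / q * ((c + k : ℕ) : ℝ) ^ 2)‖ ≤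
      A / M ^ 2 + 6 * √q * M ^ 3 := by
  have hM' : (2 : ℝ) ≤ M := by exact_mod_cast hM
  have hq2 : 2 < q := by
    have : 2 ^ 40 ≤ M ^ 40 := Nat.pow_le_pow_left hM 40
    omega
  have hq0 : (0 : ℝ) < q := by exact_mod_cast hq.pos
  have hA' : (A : ℝ) ≤ q * M := by exact_mod_cast hA
  have h1 := norm_quadratic_sum_sq_le_of_rat_approx (ξ * b ^ 2 / q) (M ^ 4)
    (one_le_pow₀ (by linarith)) _ q hq.pos (two_mul_mul_sq_isCoprime hq hq2 hξ hb0 hbq)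
    (by
      rw [show 2 * (ξ * b ^ 2 / q : ℝ) - ((2 * ξ * (b : ℤ) ^ 2 : ℤ) : ℝ) / q = 0 by
        push_cast; ring]
      simp) c n A hn
  refine abs_le_of_sq_le_sq' (h1.trans ?_) (by positivity) |>.2
  have hs : √(q : ℝ) ^ 2 = q := Real.sq_sqrt hq0.le
  have h2 : 4 * (A : ℝ) ^ 2 / q ≤ 4 * (q * M ^ 2) := by
    rw [div_le_iff₀ hq0]
    have := pow_le_pow_left₀ (Nat.cast_nonneg A) hA' 2
    nlinarith
  have h3 : 19 * (A : ℝ) * M ^ 4 ≤ 19 * (q * M) * M ^ 4 := by gcongr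
  have h4 : (A / M ^ 2 + 6 * √q * M ^ 3 : ℝ) ^ 2 =
      A ^ 2 / M ^ 4 + 12 * (A / M ^ 2) * √q * M ^ 3 + 36 * q * M ^ 6 := by
    generalize √(q : ℝ) = x at hs
    rw [← hs]
    field_simp
    ring
  have h5 : (0 : ℝ) ≤ 12 * (A / M ^ 2) * √q * M ^ 3 := by positivity
  have h6 : (q : ℝ) * M ^ 5 ≤ q * M ^ 6 := by gcongr <;> linarith
  have h7 : (q : ℝ) * M ^ 4 ≤ q * M ^ 6 := by gcongr <;> linarith
  have h8 : (q : ℝ) * M ^ 2 ≤ q * M ^ 6 := by gcongr <;> linarith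
  have h9 : (0 : ℝ) ≤ q * M ^ 6 := by positivity
  rw [h4]
  linarith

lemma norm_quadratic_sum_le_of_large_den {q M : ℕ} (hM : 2 ≤ M)
    {θ : ℝ} {ρ : ℚ}
    (happ : |2 * θ - ρ| ≤ 1 / (((q / M ^ 12 : ℕ) + 1) * ρ.den)) (hden : ρ.den ≤ q / M ^ 12)
    (hlarge : M ^ 4 ≤ ρ.den) (c n A : ℕ) (hn : n ≤ A) :
    ‖∑ k ∈ Finset.range n, unitExp (θ * ((c + k : ℕ) : ℝ) ^ 2)‖ ≤
      4 * (A / M ^ 2 + M ^ 6 + √q / M ^ 4) := by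
  have hM' : (2 : ℝ) ≤ M := by exact_mod_cast hM
  have hM0 : (0 : ℝ) < M := by linarith
  have hd0 : (0 : ℝ) < ρ.den := by exact_mod_cast ρ.den_pos
  have hden' : (ρ.den : ℝ) ≤ (q / M ^ 12 : ℕ) := by exact_mod_cast hden
  have h1 := norm_quadratic_sum_sq_le_of_rat_approx θ (M ^ 4)
    (one_le_pow₀ (by linarith)) ρ.num ρ.den ρ.den_pos
    (by rw [Int.isCoprime_iff_gcd_eq_one]; exact ρ.reduced)
    (by
      rw [← Rat.cast_def]
      refine happ.trans ?_
      rw [sq]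
      gcongr
      linarith) c n A hn
  refine abs_le_of_sq_le_sq' (h1.trans ?_) (by positivity) |>.2
  have hs : √(q : ℝ) ^ 2 = q := Real.sq_sqrt (Nat.cast_nonneg q)
  have h2 : 4 * (A : ℝ) ^ 2 / ρ.den ≤ 4 * (A ^ 2 / M ^ 4) := by
    rw [mul_div_assoc]
    have : (M ^ 4 : ℝ) ≤ ρ.den := by exact_mod_cast hlarge
    gcongr
  have h3 : 8 * (ρ.den : ℝ) * M ^ 4 ≤ 8 * (q / M ^ 8 : ℝ) := by
    have : (ρ.den : ℝ) ≤ q / M ^ 12 := hden'.trans (by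
      refine Nat.cast_div_le.trans (le_of_eq ?_)
      push_cast
      rfl)
    calc 8 * (ρ.den : ℝ) * M ^ 4 ≤ 8 * (q / M ^ 12 : ℝ) * M ^ 4 := by gcongr
      _ = 8 * (q / M ^ 8 : ℝ) := by field_simp
  have h4 : (4 * (A / M ^ 2 + M ^ 6 + √q / M ^ 4) : ℝ) ^ 2 =
      16 * (A ^ 2 / M ^ 4) + 16 * (q / M ^ 8) + 32 * A * M ^ 4 + 16 * M ^ 12 +
      32 * (A / M ^ 2 * (√q / M ^ 4)) + 32 * (M ^ 6 * (√q / M ^ 4)) := by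
    generalize √(q : ℝ) = x at hs
    rw [← hs]
    field_simp
    ring
  have h5 : (0 : ℝ) ≤ 32 * (A / M ^ 2 * (√q / M ^ 4)) := by positivity
  have h6 : (0 : ℝ) ≤ 32 * (M ^ 6 * (√q / M ^ 4)) := by positivity
  have h7 : (0 : ℝ) ≤ A ^ 2 / M ^ 4 := by positivity
  have h8 : (0 : ℝ) ≤ q / M ^ 8 := by positivity
  have h9 : (0 : ℝ) ≤ (M : ℝ) ^ 12 := by positivity
  have h10 : (0 : ℝ) ≤ A * (M : ℝ) ^ 4 := by positivity
  rw [h4]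
  linarith

/-- Few of the frequencies `2ξb²/q` are well approximated by rationals of small denominator. -/
lemma card_small_den_le {q M : ℕ} (hM : 2 ≤ M) (hMq : M ^ 40 ≤ q)
    (hq : q.Prime) {ξ : ℤ} (hξ : Int.gcd ξ q = 1) {B : ℕ} (hB : 2 * B < q)
    (ρ : ℕ → ℚ)
    (happ : ∀ b : ℕ, |2 * (ξ * b ^ 2 / q : ℝ) - ρ b| ≤
      1 / (((q / M ^ 12 : ℕ) + 1) * (ρ b).den)) :
    ((Finset.Icc 1 B).filter fun b => (ρ b).den < M ^ 4).card ≤ 3 * M ^ 16 := by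
  have hq2 : 2 < q := by
    have : 2 ^ 40 ≤ M ^ 40 := Nat.pow_le_pow_left hM 40
    omega
  have hq0 : (0 : ℝ) < q := by exact_mod_cast hq.pos
  have hMn : 0 < M := by omega
  set τ : ℕ → ℤ := fun b => 2 * ξ * b ^ 2 * (ρ b).den - (ρ b).num * q with hτ
  have hτb : ∀ b, |τ b| ≤ (M ^ 12 : ℕ) := by
    intro b
    have hd0 : (0 : ℝ) < (ρ b).den := by exact_mod_cast (ρ b).den_pos
    have h1 := happ b
    have h2 : (τ b : ℝ) = (2 * (ξ * b ^ 2 / q : ℝ) - ρ b) * ((ρ b).den * q) := by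
      simp only [hτ]
      push_cast
      rw [Rat.cast_def]
      field_simp
    have h3 : |(τ b : ℝ)| ≤ M ^ 12 := by
      rw [h2, abs_mul, abs_of_pos (by positivity : (0 : ℝ) < (ρ b).den * q)]
      calc _ ≤ 1 / (((q / M ^ 12 : ℕ) + 1) * (ρ b).den) * ((ρ b).den * q : ℝ) := by gcongr
        _ = q / ((q / M ^ 12 : ℕ) + 1) := by field_simp
        _ ≤ M ^ 12 := by
          rw [div_le_iff₀ (by positivity)]
          have := Nat.lt_mul_div_succ q (show 0 < M ^ 12 by positivity)
          exact_mod_cast this.le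
    exact_mod_cast h3
  have hcard : ((Finset.Icc 1 B).filter fun b => (ρ b).den < M ^ 4).card ≤
      (Finset.range (M ^ 4) ×ˢ Finset.Icc (-(M ^ 12 : ℕ) : ℤ) (M ^ 12 : ℕ)).card := by
    refine Finset.card_le_card_of_injOn (fun b => ((ρ b).den, τ b)) ?_ ?_
    · intro b hb
      simp only [Finset.coe_filter, Finset.mem_Icc, Set.mem_ofPred_eq] at hb
      simp only [Finset.coe_product, Set.mem_prod, Finset.coe_range, Set.mem_Iio,
        Finset.coe_Icc, Set.mem_Icc]
      exact ⟨hb.2, abs_le.1 (hτb b)⟩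
    · intro b hb b' hb' heq
      simp only [Finset.coe_filter, Finset.mem_Icc, Set.mem_ofPred_eq] at hb hb'
      simp only [Prod.mk.injEq, hτ] at heq
      obtain ⟨he1, he2⟩ := heq
      rw [he1] at he2
      have hp : Prime (q : ℤ) := Nat.prime_iff_prime_int.1 hq
      have hdvd : (q : ℤ) ∣ 2 * ξ * (ρ b').den * ((b - b') * (b + b')) :=
        ⟨(ρ b).num - (ρ b').num, by linear_combination he2⟩
      have hlt : (ρ b').den < q := by
        calc (ρ b').den < M ^ 4 := hb'.2
          _ ≤ M ^ 40 := Nat.pow_le_pow_right hMn (by norm_num)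
          _ ≤ q := hMq
      have hc : IsCoprime (q : ℤ) (2 * ξ * (ρ b').den) := by
        refine (IsCoprime.mul_left (IsCoprime.mul_left ?_
          (Int.isCoprime_iff_gcd_eq_one.2 hξ)) ?_).symm
        · exact Nat.isCoprime_iff_coprime.2
            ((Nat.coprime_primes Nat.prime_two hq).2 (by omega))
        · exact Nat.isCoprime_iff_coprime.2
            (Nat.coprime_of_lt_prime (ρ b').den_pos.ne' hlt hq).symm
      rcases hp.dvd_or_dvd (hc.dvd_of_dvd_mul_left hdvd) with h | h
      · have := Int.eq_zero_of_abs_lt_dvd h (by rw [abs_lt]; constructor <;> omega)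
        omega
      · have := Int.le_of_dvd (by omega) h
        omega
  refine hcard.trans ?_
  rw [Finset.card_product, Finset.card_range, Int.card_Icc,
    show ((M ^ 12 : ℕ) + 1 - -(M ^ 12 : ℕ) : ℤ).toNat = 2 * M ^ 12 + 1 by omega]
  have : 1 ≤ M ^ 12 := Nat.one_le_pow _ _ hMn
  calc M ^ 4 * (2 * M ^ 12 + 1) ≤ M ^ 4 * (3 * M ^ 12) := by gcongr; omega
    _ = 3 * M ^ 16 := by ring

/-- Weyl sums `∑ₐ e(ξb²a²/q)` are small on average over `b`. -/
lemma sum_norm_quadratic_sum_le {q M : ℕ} (hM : 2 ≤ M) (hMq : M ^ 40 ≤ q)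
    (hq : q.Prime) {ξ : ℤ} (hξ : Int.gcd ξ q = 1) {B N : ℕ}
    (hN : 1 ≤ N) (hNq : N ≤ q * M) (hB : B ^ 2 ≤ N) (c n : ℕ → ℕ)
    (hn : ∀ b, n b ≤ N / b) :
    ∑ b ∈ Finset.Icc 1 B,
      ‖∑ k ∈ Finset.range (n b), unitExp (ξ * b ^ 2 / q * ((c b + k : ℕ) : ℝ) ^ 2)‖ ≤
      30 * (q / M) * (1 + Real.log N) := by
  have hM' : (2 : ℝ) ≤ M := by exact_mod_cast hM
  have hM0 : (0 : ℝ) < M := by linarith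
  have hM1 : (1 : ℝ) ≤ M := by linarith
  have hMn : 0 < M := by omega
  have hq0 : (0 : ℝ) < q := by exact_mod_cast hq.pos
  have hlog : 0 ≤ Real.log N := Real.log_natCast_nonneg N
  have hB2 : 2 * B < q := by
    by_contra! hcon
    have h1 : q ^ 2 ≤ 4 * (q * M) := by
      calc q ^ 2 ≤ (2 * B) ^ 2 := Nat.pow_le_pow_left hcon 2
        _ = 4 * B ^ 2 := by ring
        _ ≤ 4 * (q * M) := by omega
    have h2 : q ≤ 4 * M := by
      refine Nat.le_of_mul_le_mul_left ?_ hq.pos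
      nlinarith
    have h3 : 4 * M < M ^ 40 := by
      calc 4 * M < 2 ^ 39 * M := by omega
        _ ≤ M ^ 39 * M := by gcongr
        _ = M ^ 40 := by ring
    omega
  have hBN : B ≤ N := by nlinarith
  have hn1 : 0 < q / M ^ 12 :=
    Nat.div_pos ((Nat.pow_le_pow_right hMn (by norm_num)).trans hMq) (by positivity)
  choose ρ happ hden using fun b : ℕ =>
    Real.exists_rat_abs_sub_le_and_den_le (2 * (ξ * b ^ 2 / q : ℝ)) hn1
  have hbad := card_small_den_le hM hMq hq hξ hB2 ρ happ
  have hpt : ∀ b ∈ Finset.Icc 1 B,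
      ‖∑ k ∈ Finset.range (n b), unitExp (ξ * b ^ 2 / q * ((c b + k : ℕ) : ℝ) ^ 2)‖ ≤
      4 / M ^ 2 * N * (b : ℝ)⁻¹ + (4 * M ^ 6 + 4 * √q / M ^ 4) +
        (if (ρ b).den < M ^ 4 then 6 * √q * M ^ 3 else 0) := by
    intro b hb
    have hb' := Finset.mem_Icc.1 hb
    have hA : ((N / b : ℕ) : ℝ) ≤ N * (b : ℝ)⁻¹ := by
      rw [← div_eq_mul_inv]
      exact Nat.cast_div_le
    have hA2 : ((N / b : ℕ) : ℝ) / M ^ 2 ≤ N * (b : ℝ)⁻¹ / M ^ 2 := by gcongr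
    have e1 : 4 / (M : ℝ) ^ 2 * N * (b : ℝ)⁻¹ = 4 * (N * (b : ℝ)⁻¹ / M ^ 2) := by ring
    have p1 : (0 : ℝ) ≤ N * (b : ℝ)⁻¹ / M ^ 2 := by positivity
    have p2 : 0 ≤ 4 * (M : ℝ) ^ 6 := by positivity
    have p3 : 0 ≤ 4 * √q / (M : ℝ) ^ 4 := by positivity
    split_ifs with h
    · have := norm_quadratic_sum_le_of_prime hM hMq hq hξ (b := b) (by omega) (by omega) (c b)
        (n b) (N / b) (hn b) ((Nat.div_le_self N b).trans hNq)
      linarith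
    · have := norm_quadratic_sum_le_of_large_den hM (happ b) (hden b) (not_lt.1 h) (c b)
        (n b) (N / b) (hn b)
      have e2 : 4 * (√q / (M : ℝ) ^ 4) = 4 * √q / (M : ℝ) ^ 4 := by ring
      linarith
  refine (Finset.sum_le_sum hpt).trans ?_
  rw [Finset.sum_add_distrib, Finset.sum_add_distrib, ← Finset.mul_sum, Finset.sum_const,
    ← Finset.sum_filter, Finset.sum_const, Nat.card_Icc, nsmul_eq_mul, nsmul_eq_mul]
  have hharm : ∑ b ∈ Finset.Icc 1 B, (b : ℝ)⁻¹ ≤ 1 + Real.log N := by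
    have h1 := harmonic_le_one_add_log N
    rw [harmonic_eq_sum_Icc] at h1
    push_cast at h1
    refine le_trans (Finset.sum_le_sum_of_subset_of_nonneg
      (Finset.Icc_subset_Icc_right hBN) fun _ _ _ => by positivity) h1
  set x := √(q : ℝ) with hx
  have hx2 : x ^ 2 = q := Real.sq_sqrt hq0.le
  have hx0 : 0 < x := Real.sqrt_pos.2 hq0
  have hMx : (M : ℝ) ^ 20 ≤ x := by
    rw [hx]
    apply Real.le_sqrt_of_sq_le
    rw [← pow_mul]
    exact_mod_cast hMq
  have hNr : (N : ℝ) ≤ q * M := by exact_mod_cast hNq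
  have hBx : (B : ℝ) ≤ x * M := by
    refine abs_le_of_sq_le_sq' (a := (B : ℝ)) ?_ (by positivity) |>.2
    have : (B : ℝ) ^ 2 ≤ N := by exact_mod_cast hB
    rw [mul_pow, hx2]
    refine this.trans (hNr.trans ?_)
    gcongr
    nlinarith
  have t1 : 4 / (M : ℝ) ^ 2 * N * ∑ b ∈ Finset.Icc 1 B, (b : ℝ)⁻¹ ≤
      4 * (q / M) * (1 + Real.log N) := by
    calc _ ≤ 4 / (M : ℝ) ^ 2 * (q * M) * (1 + Real.log N) := by gcongr
      _ = 4 * (q / M) * (1 + Real.log N) := by field_simp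
  have key : x * (M : ℝ) ^ 19 ≤ q / M := by
    rw [le_div_iff₀ hM0, ← hx2]
    calc x * (M : ℝ) ^ 19 * M = x * M ^ 20 := by ring
      _ ≤ x * x := by gcongr
      _ = x ^ 2 := by ring
  have t2 : ((B + 1 - 1 : ℕ) : ℝ) * (4 * M ^ 6 + 4 * x / M ^ 4) ≤ 8 * (q / M) := by
    rw [Nat.add_sub_cancel]
    have u1 : x * (M : ℝ) ^ 7 ≤ q / M :=
      le_trans (by gcongr; norm_num) key
    have u2 : (q / M : ℝ) / M ^ 2 ≤ q / M := div_le_self (by positivity) (one_le_pow₀ hM1)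
    calc (B : ℝ) * (4 * M ^ 6 + 4 * x / M ^ 4) ≤ (x * M) * (4 * M ^ 6 + 4 * x / M ^ 4) := by
          gcongr
      _ = 4 * (x * M ^ 7) + 4 * ((q / M : ℝ) / M ^ 2) := by
          rw [← hx2]
          field_simp
      _ ≤ 8 * (q / M) := by linarith
  have t3 : (((Finset.Icc 1 B).filter fun b => (ρ b).den < M ^ 4).card : ℝ) *
      (6 * x * M ^ 3) ≤ 18 * (q / M) := by
    calc _ ≤ (3 * M ^ 16 : ℝ) * (6 * x * M ^ 3) := by
          gcongr
          exact_mod_cast hbad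
      _ = 18 * (x * M ^ 19) := by ring
      _ ≤ 18 * (q / M) := by gcongr
  have hqM : (0 : ℝ) ≤ q / M := by positivity
  nlinarith [mul_nonneg hqM hlog]

/-- Pairs of positive integers with product at most `N`. -/
def hyperbolaPairs (N : ℕ) : Finset (ℕ × ℕ) :=
  (Finset.Icc 1 N ×ˢ Finset.Icc 1 N).filter fun p => p.1 * p.2 ≤ N

lemma mem_hyperbolaPairs {N : ℕ} {p : ℕ × ℕ} :
    p ∈ hyperbolaPairs N ↔ 1 ≤ p.1 ∧ 1 ≤ p.2 ∧ p.1 * p.2 ≤ N := by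
  simp only [hyperbolaPairs, Finset.mem_filter, Finset.mem_product, Finset.mem_Icc]
  constructor
  · rintro ⟨⟨h1, h2⟩, h3⟩
    exact ⟨h1.1, h2.1, h3⟩
  · rintro ⟨h1, h2, h3⟩
    exact ⟨⟨⟨h1, by nlinarith⟩, ⟨h2, by nlinarith⟩⟩, h3⟩

lemma sum_card_divisors_mul {R : Type*} [Semiring R] (F : ℕ → R) (N : ℕ) :
    ∑ n ∈ Finset.Icc 1 N, (n.divisors.card : R) * F n =
      ∑ p ∈ hyperbolaPairs N, F (p.1 * p.2) := by
  rw [← Finset.sum_fiberwise_of_maps_to (s := hyperbolaPairs N) (t := Finset.Icc 1 N)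
    (g := fun p => p.1 * p.2)]
  · refine Finset.sum_congr rfl fun n hn => ?_
    have hn' := Finset.mem_Icc.1 hn
    have h1 : (hyperbolaPairs N).filter (fun p => p.1 * p.2 = n) = n.divisorsAntidiagonal := by
      ext p
      simp only [Finset.mem_filter, mem_hyperbolaPairs, Nat.mem_divisorsAntidiagonal]
      constructor
      · rintro ⟨-, h⟩
        exact ⟨h, by omega⟩
      · rintro ⟨h, -⟩
        have hp : 0 < p.1 * p.2 := by omega
        exact ⟨⟨Nat.pos_of_mul_pos_right hp, Nat.pos_of_mul_pos_left hp, by omega⟩, h⟩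
    rw [h1, Finset.sum_congr rfl (g := fun _ => F n)
      (fun p hp => by rw [(Nat.mem_divisorsAntidiagonal.1 hp).1]), Finset.sum_const,
      nsmul_eq_mul, ← Nat.map_div_right_divisors, Finset.card_map]
  · intro p hp
    obtain ⟨h1, h2, h3⟩ := mem_hyperbolaPairs.1 hp
    exact Finset.mem_Icc.2 ⟨Nat.one_le_iff_ne_zero.2 (by positivity), h3⟩

lemma sum_card_divisors_mul_rpow_le (N : ℕ) :
    ∑ n ∈ Finset.Icc 1 N, (n.divisors.card : ℝ) * (n : ℝ) ^ (-(1 / 2 : ℝ)) ≤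
      √N * (1 + Real.log N) ^ 2 := by
  rw [sum_card_divisors_mul (fun n : ℕ => (n : ℝ) ^ (-(1 / 2 : ℝ)))]
  have hharm : ∑ b ∈ Finset.Icc 1 N, (b : ℝ)⁻¹ ≤ 1 + Real.log N := by
    have h1 := harmonic_le_one_add_log N
    rw [harmonic_eq_sum_Icc] at h1
    push_cast at h1
    exact h1
  have h0 : 0 ≤ ∑ b ∈ Finset.Icc 1 N, (b : ℝ)⁻¹ := Finset.sum_nonneg fun _ _ => by positivity
  calc ∑ p ∈ hyperbolaPairs N, ((p.1 * p.2 : ℕ) : ℝ) ^ (-(1 / 2 : ℝ))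
      ≤ ∑ p ∈ hyperbolaPairs N, √N * ((p.1 : ℝ)⁻¹ * (p.2 : ℝ)⁻¹) := by
        refine Finset.sum_le_sum fun p hp => ?_
        obtain ⟨h1, h2, h3⟩ := mem_hyperbolaPairs.1 hp
        have hpos : (0 : ℝ) < (p.1 * p.2 : ℕ) := by exact_mod_cast Nat.mul_pos h1 h2
        rw [← mul_inv, ← Nat.cast_mul, Real.rpow_neg hpos.le, ← Real.sqrt_eq_rpow,
          ← div_eq_mul_inv, inv_eq_one_div, div_le_div_iff₀ (Real.sqrt_pos.2 hpos) hpos]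
        nth_rewrite 1 [← Real.mul_self_sqrt hpos.le]
        rw [one_mul]
        gcongr
    _ ≤ ∑ p ∈ Finset.Icc 1 N ×ˢ Finset.Icc 1 N, √N * ((p.1 : ℝ)⁻¹ * (p.2 : ℝ)⁻¹) :=
        Finset.sum_le_sum_of_subset_of_nonneg (Finset.filter_subset _ _)
          fun _ _ _ => by positivity
    _ = √N * (∑ b ∈ Finset.Icc 1 N, (b : ℝ)⁻¹) ^ 2 := by
        rw [← Finset.mul_sum, sq, Finset.sum_mul_sum, Finset.sum_product]
    _ ≤ √N * (1 + Real.log N) ^ 2 := by gcongr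

/-- Dirichlet's hyperbola method for functions bounded by one. -/
lemma norm_sum_hyperbolaPairs_le (F : ℕ → ℂ) (hF : ∀ n, ‖F n‖ ≤ 1) (N : ℕ) :
    ‖∑ p ∈ hyperbolaPairs N, F (p.1 * p.2)‖ ≤ N.sqrt +
      2 * ∑ b ∈ Finset.Icc 1 N.sqrt, ‖∑ a ∈ Finset.Ioc b (N / b), F (b * a)‖ := by
  set S := N.sqrt
  have hlt : ∑ p ∈ (hyperbolaPairs N).filter (fun p => p.1 < p.2), F (p.1 * p.2) =
      ∑ b ∈ Finset.Icc 1 S, ∑ a ∈ Finset.Ioc b (N / b), F (b * a) := by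
    rw [Finset.sum_sigma']
    refine Finset.sum_bij' (fun p _ => ⟨p.1, p.2⟩) (fun p _ => (p.1, p.2)) ?_ ?_ ?_ ?_ ?_
    · intro p hp
      obtain ⟨h1, h2⟩ := Finset.mem_filter.1 hp
      obtain ⟨h3, h4, h5⟩ := mem_hyperbolaPairs.1 h1
      simp only [Finset.mem_sigma, Finset.mem_Icc, Finset.mem_Ioc]
      refine ⟨⟨h3, Nat.le_sqrt.2 (by nlinarith)⟩, h2, (Nat.le_div_iff_mul_le h3).2 ?_⟩
      rwa [mul_comm]
    · intro p hp
      simp only [Finset.mem_sigma, Finset.mem_Icc, Finset.mem_Ioc] at hp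
      obtain ⟨⟨h1, h2⟩, h3, h4⟩ := hp
      rw [Nat.le_div_iff_mul_le h1, mul_comm] at h4
      exact Finset.mem_filter.2 ⟨mem_hyperbolaPairs.2 ⟨h1, by omega, h4⟩, h3⟩
    · intro p _; rfl
    · intro p _; rfl
    · intro p _; rfl
  have hgt : ∑ p ∈ (hyperbolaPairs N).filter (fun p => p.2 < p.1), F (p.1 * p.2) =
      ∑ p ∈ (hyperbolaPairs N).filter (fun p => p.1 < p.2), F (p.1 * p.2) := by
    refine Finset.sum_bij' (fun p _ => p.swap) (fun p _ => p.swap) ?_ ?_ ?_ ?_ ?_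
    · intro p hp
      simp only [Finset.mem_filter, mem_hyperbolaPairs, Prod.fst_swap, Prod.snd_swap] at hp ⊢
      exact ⟨⟨hp.1.2.1, hp.1.1, by rw [mul_comm]; exact hp.1.2.2⟩, hp.2⟩
    · intro p hp
      simp only [Finset.mem_filter, mem_hyperbolaPairs, Prod.fst_swap, Prod.snd_swap] at hp ⊢
      exact ⟨⟨hp.1.2.1, hp.1.1, by rw [mul_comm]; exact hp.1.2.2⟩, hp.2⟩
    · intro p _; simp
    · intro p _; simp
    · intro p _; simp [mul_comm]
  have hdiag : ‖∑ p ∈ (hyperbolaPairs N).filter (fun p => p.1 = p.2), F (p.1 * p.2)‖ ≤ S := by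
    refine (norm_sum_le_of_le _ (fun p _ => hF _)).trans ?_
    rw [Finset.sum_const, nsmul_eq_mul, mul_one]
    have : ((hyperbolaPairs N).filter (fun p => p.1 = p.2)).card ≤ (Finset.Icc 1 S).card := by
      refine Finset.card_le_card_of_injOn (fun p => p.1) ?_ ?_
      · intro p hp
        simp only [Finset.coe_filter, mem_hyperbolaPairs, Set.mem_ofPred_eq] at hp
        obtain ⟨⟨h1, h2, h3⟩, h4⟩ := hp
        rw [← h4] at h3
        exact Finset.mem_coe.2 (Finset.mem_Icc.2 ⟨h1, Nat.le_sqrt.2 h3⟩)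
      · intro p hp p' hp' h
        simp only [Finset.coe_filter, Set.mem_ofPred_eq] at hp hp'
        exact Prod.ext h (by rw [← hp.2, ← hp'.2]; exact h)
    rw [Nat.card_Icc, Nat.add_sub_cancel] at this
    exact_mod_cast this
  have hsplit : ∑ p ∈ hyperbolaPairs N, F (p.1 * p.2) =
      ∑ p ∈ (hyperbolaPairs N).filter (fun p => p.1 = p.2), F (p.1 * p.2) +
      (∑ p ∈ (hyperbolaPairs N).filter (fun p => p.1 < p.2), F (p.1 * p.2) +
      ∑ p ∈ (hyperbolaPairs N).filter (fun p => p.2 < p.1), F (p.1 * p.2)) := by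
    simp only [Finset.sum_filter, ← Finset.sum_add_distrib]
    refine Finset.sum_congr rfl fun p _ => ?_
    rcases lt_trichotomy p.1 p.2 with h | h | h
    · simp [h, h.ne, h.not_gt]
    · simp [h]
    · simp [h, h.ne', h.not_gt]
  rw [hsplit, hgt, hlt, ← two_mul]
  refine (norm_add_le _ _).trans (add_le_add hdiag ?_)
  rw [norm_mul, Complex.norm_ofNat]
  exact mul_le_mul_of_nonneg_left (norm_sum_le _ _) zero_le_two

/-- The summatory function of `d(n) e(ξn²/q)` over integers prime to `q`. -/
lemma norm_sum_card_divisors_mul_unitExp_le {q M : ℕ} (hM : 2 ≤ M) (hMq : M ^ 40 ≤ q)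
    (hq : q.Prime) {ξ : ℤ} (hξ : Int.gcd ξ q = 1) {N : ℕ} (hN : 1 ≤ N) (hNq : N ≤ q * M) :
    ‖∑ n ∈ Finset.Icc 1 N, (n.divisors.card : ℂ) *
      (if Nat.gcd n q = 1 then unitExp (ξ * n ^ 2 / q) else 0)‖ ≤
      63 * (q / M) * (1 + Real.log N) := by
  have hM' : (2 : ℝ) ≤ M := by exact_mod_cast hM
  have hM0 : (0 : ℝ) < M := by linarith
  have hMn : 0 < M := by omega
  have hq0 : (0 : ℝ) < q := by exact_mod_cast hq.pos
  have hlog : 0 ≤ Real.log N := Real.log_natCast_nonneg N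
  set F : ℕ → ℂ := fun n => if Nat.gcd n q = 1 then unitExp (ξ * n ^ 2 / q) else 0 with hF
  have hF1 : ∀ n, ‖F n‖ ≤ 1 := by
    intro n
    simp only [hF]
    split_ifs
    · rw [norm_unitExp]
    · simp
  have hS : N.sqrt ^ 2 ≤ N := Nat.sqrt_le' N
  have hSM : N.sqrt * M ^ 3 ≤ q := by
    have h1 : (N.sqrt * M ^ 3) ^ 2 ≤ q ^ 2 := by
      calc (N.sqrt * M ^ 3) ^ 2 = N.sqrt ^ 2 * M ^ 6 := by ring
        _ ≤ q * M * M ^ 6 := by gcongr; omega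
        _ = q * M ^ 7 := by ring
        _ ≤ q * M ^ 40 := by gcongr ; omega
        _ ≤ q * q := by gcongr
        _ = q ^ 2 := by ring
    exact (Nat.pow_le_pow_iff_left two_ne_zero).1 h1
  have hSq : N.sqrt < q := by
    have h1 : N.sqrt * 2 ≤ N.sqrt * M ^ 3 := by
      gcongr
      calc 2 ≤ M ^ 1 := by simpa
        _ ≤ M ^ 3 := Nat.pow_le_pow_right hMn (by norm_num)
    have := hq.pos
    omega
  have hinner : ∀ b ∈ Finset.Icc 1 N.sqrt, ‖∑ a ∈ Finset.Ioc b (N / b), F (b * a)‖ ≤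
      ‖∑ k ∈ Finset.range (N / b - b),
        unitExp (ξ * b ^ 2 / q * ((b + 1 + k : ℕ) : ℝ) ^ 2)‖ + M := by
    intro b hb
    obtain ⟨hb1, hb2⟩ := Finset.mem_Icc.1 hb
    have hbq : Nat.Coprime b q := (Nat.coprime_of_lt_prime (by omega) (by omega) hq).symm
    set G : ℕ → ℂ := fun a => unitExp (ξ * b ^ 2 / q * (a : ℝ) ^ 2) with hG
    have h1 : ∀ a, F (b * a) = G a - if q ∣ a then G a else 0 := by
      intro a
      have h2 : Nat.gcd (b * a) q = 1 ↔ ¬ q ∣ a := by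
        rw [← Nat.coprime_iff_gcd_eq_one, Nat.coprime_mul_iff_left, and_iff_right hbq,
          Nat.coprime_comm, hq.coprime_iff_not_dvd]
      simp only [hF, h2]
      by_cases h : q ∣ a
      · simp [h]
      · simp only [h, not_false_eq_true, if_true, if_false, sub_zero, hG]
        congr 1
        push_cast
        ring
    have h3 : Finset.Ioc b (N / b) = Finset.Ico (b + 1) (N / b + 1) := by
      ext; simp only [Finset.mem_Ioc, Finset.mem_Ico]; omega
    have h4 : ∑ a ∈ Finset.Ioc b (N / b), G a = ∑ k ∈ Finset.range (N / b - b),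
        unitExp (ξ * b ^ 2 / q * ((b + 1 + k : ℕ) : ℝ) ^ 2) := by
      rw [h3, Finset.sum_Ico_eq_sum_range]
      simp only [hG, Nat.add_sub_add_right]
    have h5 : ‖∑ a ∈ Finset.Ioc b (N / b), if q ∣ a then G a else 0‖ ≤ M := by
      rw [← Finset.sum_filter]
      refine (norm_sum_le_of_le _ (fun a _ => (norm_unitExp _).le)).trans ?_
      rw [Finset.sum_const, nsmul_eq_mul, mul_one]
      have : ((Finset.Ioc b (N / b)).filter (q ∣ ·)).card ≤ M := by
        refine (Finset.card_le_card (Finset.filter_subset_filter _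
          (Finset.Ioc_subset_Ioc_left (Nat.zero_le b)))).trans ?_
        rw [Nat.Ioc_filter_dvd_card_eq_div]
        refine Nat.div_le_of_le_mul ((Nat.div_le_self N b).trans hNq)
      exact_mod_cast this
    rw [Finset.sum_congr rfl (fun a _ => h1 a), Finset.sum_sub_distrib, h4]
    exact (norm_sub_le _ _).trans (add_le_add le_rfl h5)
  rw [sum_card_divisors_mul F]
  refine (norm_sum_hyperbolaPairs_le F hF1 N).trans ?_
  have hmain := sum_norm_quadratic_sum_le hM hMq hq hξ hN hNq hS (fun b => b + 1)
    (fun b => N / b - b) (fun b => Nat.sub_le _ _)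
  have hsum := Finset.sum_le_sum hinner
  rw [Finset.sum_add_distrib, Finset.sum_const, Nat.card_Icc, Nat.add_sub_cancel,
    nsmul_eq_mul] at hsum
  have hSM' : (N.sqrt : ℝ) * M ^ 3 ≤ q := by exact_mod_cast hSM
  have e1 : (N.sqrt : ℝ) * M ≤ q / M := by
    rw [le_div_iff₀ hM0]
    refine le_trans (le_of_eq_of_le ?_ (mul_le_mul_of_nonneg_left
      (pow_le_pow_right₀ (show (1 : ℝ) ≤ M by linarith) (show 2 ≤ 3 by norm_num))
      (Nat.cast_nonneg N.sqrt))) hSM'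
    ring
  have e2 : (N.sqrt : ℝ) ≤ N.sqrt * M := le_mul_of_one_le_right (Nat.cast_nonneg _) (by linarith)
  have hqM : (0 : ℝ) ≤ q / M := by positivity
  nlinarith [mul_nonneg hqM hlog]

lemma norm_sum_card_divisors_mul_unitExp_le_sq (q : ℕ) (ξ : ℤ) (N : ℕ) :
    ‖∑ n ∈ Finset.Icc 1 N, (n.divisors.card : ℂ) *
      (if Nat.gcd n q = 1 then unitExp (ξ * n ^ 2 / q) else 0)‖ ≤ (N : ℝ) ^ 2 := by
  have h : ∀ n ∈ Finset.Icc 1 N, ‖(n.divisors.card : ℂ) *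
      (if Nat.gcd n q = 1 then unitExp (ξ * n ^ 2 / q) else 0)‖ ≤ N := by
    intro n hn
    rw [norm_mul, Complex.norm_natCast]
    have h1 : (n.divisors.card : ℝ) ≤ N := by
      exact_mod_cast (Nat.card_divisors_le_self n).trans (Finset.mem_Icc.1 hn).2
    refine (mul_le_of_le_one_right (Nat.cast_nonneg _) ?_).trans h1
    split_ifs
    · rw [norm_unitExp]
    · simp
  refine (norm_sum_le_of_le _ h).trans (le_of_eq ?_)
  simp [sq]

lemma exists_norm_sum_card_divisors_mul_unitExp_le :
    ∃ C : ℝ, 0 < C ∧ ∀ q : ℕ, q.Prime → ∀ ξ : ℤ, Int.gcd ξ q = 1 → ∀ N : ℕ, 1 ≤ N →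
      ‖∑ n ∈ Finset.Icc 1 N, (n.divisors.card : ℂ) *
        (if Nat.gcd n q = 1 then unitExp (ξ * n ^ 2 / q) else 0)‖ ≤
      C * (q : ℝ) ^ (79 / 80 : ℝ) * max 1 ((N : ℝ) / q) ^ 43 := by
  refine ⟨2 ^ 80, by positivity, fun q hq ξ hξ N hN => ?_⟩
  have hq0 : (0 : ℝ) < q := by exact_mod_cast hq.pos
  have hq1 : (1 : ℝ) ≤ q := by exact_mod_cast hq.one_le
  set y : ℝ := N / q with hy
  have hNy : (N : ℝ) = q * y := by rw [hy]; field_simp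
  have hy0 : 0 ≤ y := by positivity
  have hm1 : 1 ≤ max 1 y := le_max_left _ _
  have hmy : y ≤ max 1 y := le_max_right _ _
  have htriv := norm_sum_card_divisors_mul_unitExp_le_sq q ξ N
  have hqsplit : (q : ℝ) ^ 2 = (q : ℝ) ^ (79 / 80 : ℝ) * (q : ℝ) ^ (81 / 80 : ℝ) := by
    rw [← Real.rpow_add hq0, ← Real.rpow_natCast]
    norm_num
  rw [hNy, mul_pow, hqsplit] at htriv
  rcases lt_or_ge q (2 ^ 40) with hlt | hge
  · refine htriv.trans ?_
    have h1 : (q : ℝ) ^ (81 / 80 : ℝ) ≤ 2 ^ 80 := by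
      have h2 : (q : ℝ) ≤ 2 ^ 40 := by exact_mod_cast hlt.le
      calc (q : ℝ) ^ (81 / 80 : ℝ) ≤ (q : ℝ) ^ (2 : ℝ) :=
            Real.rpow_le_rpow_of_exponent_le hq1 (by norm_num)
        _ = (q : ℝ) ^ 2 := Real.rpow_two _
        _ ≤ (2 ^ 40) ^ 2 := by gcongr
        _ = 2 ^ 80 := by norm_num
    have h3 : y ^ 2 ≤ max 1 y ^ 43 := (pow_le_pow_left₀ hy0 hmy 2).trans
      (pow_le_pow_right₀ hm1 (by norm_num))
    calc (q : ℝ) ^ (79 / 80 : ℝ) * (q : ℝ) ^ (81 / 80 : ℝ) * y ^ 2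
        ≤ (q : ℝ) ^ (79 / 80 : ℝ) * 2 ^ 80 * max 1 y ^ 43 := by gcongr
      _ = _ := by ring
  · set u : ℝ := (q : ℝ) ^ (1 / 40 : ℝ) with hu
    have hu0 : 0 < u := Real.rpow_pos_of_pos hq0 _
    have hu40 : u ^ 40 = q := by
      rw [hu, ← Real.rpow_natCast, ← Real.rpow_mul hq0.le]
      norm_num
    have hu2 : 2 ≤ u := by
      refine (pow_le_pow_iff_left₀ zero_le_two hu0.le (show 40 ≠ 0 by norm_num)).1 ?_
      rw [hu40]
      exact_mod_cast hge
    set M := ⌊u⌋₊ with hMdef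
    have hM2 : 2 ≤ M := Nat.le_floor (by exact_mod_cast hu2)
    have hMu : (M : ℝ) ≤ u := Nat.floor_le hu0.le
    have huM : u < M + 1 := Nat.lt_floor_add_one u
    have hM2' : (2 : ℝ) ≤ M := by exact_mod_cast hM2
    have huM2 : u ≤ 2 * M := by linarith
    have hMq : M ^ 40 ≤ q := by
      have : (M : ℝ) ^ 40 ≤ q := by
        rw [← hu40]
        gcongr
      exact_mod_cast this
    rcases le_or_gt N (q * M) with hNM | hNM
    · refine (norm_sum_card_divisors_mul_unitExp_le hM2 hMq hq hξ hN hNM).trans ?_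
      have h1 : Real.log N ≤ 2 * Real.log q := by
        rw [← Real.log_rpow hq0, Real.rpow_two]
        have hMq1 : M ≤ q := (Nat.le_self_pow (by norm_num) M).trans hMq
        have : N ≤ q ^ 2 := by nlinarith
        exact Real.log_le_log (by exact_mod_cast hN) (by exact_mod_cast this)
      have h2 : Real.log q ≤ 80 * (q : ℝ) ^ (1 / 80 : ℝ) := by
        have := Real.log_le_rpow_div hq0.le (show (0 : ℝ) < 1 / 80 by norm_num)
        rw [div_div_eq_mul_div, div_one] at this
        linarith
      have h3 : 1 ≤ (q : ℝ) ^ (1 / 80 : ℝ) := Real.one_le_rpow hq1 (by norm_num)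
      have h4 : (q / M : ℝ) ≤ 2 * (q : ℝ) ^ (39 / 40 : ℝ) := by
        rw [div_le_iff₀ (by linarith)]
        have h5 : (q : ℝ) = (q : ℝ) ^ (39 / 40 : ℝ) * u := by
          rw [hu, ← Real.rpow_add hq0]
          norm_num
        have h6 : 0 < (q : ℝ) ^ (39 / 40 : ℝ) := Real.rpow_pos_of_pos hq0 _
        calc (q : ℝ) = (q : ℝ) ^ (39 / 40 : ℝ) * u := h5
          _ ≤ (q : ℝ) ^ (39 / 40 : ℝ) * (2 * M) := by gcongr
          _ = _ := by ring
      have h7 : (q : ℝ) ^ (79 / 80 : ℝ) =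
          (q : ℝ) ^ (39 / 40 : ℝ) * (q : ℝ) ^ (1 / 80 : ℝ) := by
        rw [← Real.rpow_add hq0]
        norm_num
      have hlog : 0 ≤ Real.log N := Real.log_natCast_nonneg N
      calc 63 * (q / M : ℝ) * (1 + Real.log N)
          ≤ 63 * (2 * (q : ℝ) ^ (39 / 40 : ℝ)) * (161 * (q : ℝ) ^ (1 / 80 : ℝ)) := by
            gcongr
            linarith
        _ = 20286 * (q : ℝ) ^ (79 / 80 : ℝ) * 1 := by rw [h7]; ring
        _ ≤ 2 ^ 80 * (q : ℝ) ^ (79 / 80 : ℝ) * max 1 y ^ 43 := by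
            gcongr
            · norm_num
            · exact one_le_pow₀ hm1
    · refine htriv.trans ?_
      have hMy : (M : ℝ) ≤ y := by
        rw [hy, le_div_iff₀ hq0, mul_comm]
        exact_mod_cast hNM.le
      have h1 : (q : ℝ) ^ (81 / 80 : ℝ) ≤ 2 ^ 80 * y ^ 41 := by
        calc (q : ℝ) ^ (81 / 80 : ℝ) ≤ (q : ℝ) ^ (41 / 40 : ℝ) :=
              Real.rpow_le_rpow_of_exponent_le hq1 (by norm_num)
          _ = u ^ 41 := by
              rw [hu, ← Real.rpow_natCast, ← Real.rpow_mul hq0.le]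
              norm_num
          _ ≤ (2 * y) ^ 41 := by gcongr; linarith
          _ = 2 ^ 41 * y ^ 41 := by ring
          _ ≤ 2 ^ 80 * y ^ 41 := by gcongr <;> norm_num
      calc (q : ℝ) ^ (79 / 80 : ℝ) * (q : ℝ) ^ (81 / 80 : ℝ) * y ^ 2
          ≤ (q : ℝ) ^ (79 / 80 : ℝ) * (2 ^ 80 * y ^ 41) * y ^ 2 := by gcongr
        _ = 2 ^ 80 * (q : ℝ) ^ (79 / 80 : ℝ) * y ^ 43 := by ring
        _ ≤ 2 ^ 80 * (q : ℝ) ^ (79 / 80 : ℝ) * max 1 y ^ 43 := by gcongr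

/-- Abel summation over an interval. -/
lemma sum_Ico_mul_eq_sub (f g : ℕ → ℂ) {m n : ℕ} (hmn : m ≤ n) :
    ∑ k ∈ Finset.Ico m n, f k * g k = (∑ k ∈ Finset.range n, f k) * g n -
      (∑ k ∈ Finset.range m, f k) * g m -
      ∑ k ∈ Finset.Ico m n, (∑ j ∈ Finset.range (k + 1), f j) * (g (k + 1) - g k) := by
  induction n, hmn using Nat.le_induction with
  | base => simp
  | succ n hmn ih =>
    rw [Finset.sum_Ico_succ_top hmn, Finset.sum_Ico_succ_top hmn, ih, Finset.sum_range_succ]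
    ring

lemma Admissible.differentiableAt {V : ℝ → ℂ} (hV : Admissible V) {y : ℝ} (hy : 0 < y) :
    DifferentiableAt ℝ V y :=
  ((hV.1.differentiableOn (by simp)) y hy).differentiableAt (Ioi_mem_nhds hy)

lemma Admissible.exists_norm_le {V : ℝ → ℂ} (hV : Admissible V) (K : ℕ) :
    ∃ C : ℝ, 0 < C ∧ ∀ y : ℝ, 0 < y → ‖V y‖ ≤ C ∧ ‖V y‖ * (y ^ 2 * max 1 y ^ K) ≤ C ∧
      ‖deriv V y‖ * (y ^ 3 * max 1 y ^ K) ≤ C := by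
  have hA : (1 : ℝ) < (K + 2 : ℕ) := by
    exact_mod_cast (show 1 < K + 2 by omega)
  obtain ⟨C₁, h₁⟩ := hV.2.1 2 one_lt_two
  obtain ⟨C₂, h₂⟩ := hV.2.2.1 (K + 2 : ℕ) hA
  obtain ⟨C₃, h₃⟩ := hV.2.2.2 1 le_rfl 2 one_lt_two
  obtain ⟨C₄, h₄⟩ := hV.2.2.2 1 le_rfl (K + 2 : ℕ) hA
  have hd : ∀ y : ℝ, 0 < y → iteratedDerivWithin 1 V (Set.Ioi 0) y = deriv V y := by
    intro y hy
    rw [iteratedDerivWithin_one, derivWithin_of_isOpen isOpen_Ioi hy]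
  refine ⟨1 + |C₁| + |C₂| + |C₃| + |C₄|, by positivity, fun y hy => ?_⟩
  have a1 := le_abs_self C₁
  have a2 := le_abs_self C₂
  have a3 := le_abs_self C₃
  have a4 := le_abs_self C₄
  have b1 := abs_nonneg C₁
  have b2 := abs_nonneg C₂
  have b3 := abs_nonneg C₃
  have b4 := abs_nonneg C₄
  rcases le_total y 1 with hy1 | hy1
  · have e1 := h₁ y hy
    have e3 := h₃ y hy
    rw [hd y hy, Real.rpow_neg hy.le, Real.rpow_two, ← div_eq_mul_inv,
      le_div_iff₀ (by positivity)] at e3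
    rw [Real.rpow_two] at e1
    have hsq : y ^ 2 ≤ 1 := pow_le_one₀ hy.le hy1
    have e2 : ‖V y‖ ≤ 1 + |C₁| := by
      have h5 : ‖V y‖ ≤ ‖V y - 1‖ + 1 := by
        have := norm_add_le (V y - 1) 1
        simpa using this
      have h6 : C₁ * y ^ 2 ≤ |C₁| := by
        calc C₁ * y ^ 2 ≤ |C₁| * y ^ 2 := by gcongr
          _ ≤ |C₁| * 1 := by gcongr
          _ = |C₁| := mul_one _
      linarith
    rw [max_eq_left hy1, one_pow, mul_one, mul_one]
    refine ⟨by linarith, ?_, ?_⟩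
    · have := mul_le_of_le_one_right (norm_nonneg (V y)) hsq
      linarith
    · have : ‖deriv V y‖ * y ^ 3 = y ^ 1 * ‖deriv V y‖ * y ^ 2 := by ring
      linarith
  · have e2 := h₂ y hy1
    have e4 := h₄ y hy
    rw [Real.rpow_neg hy.le, Real.rpow_natCast, ← div_eq_mul_inv,
      le_div_iff₀ (by positivity)] at e2 e4
    rw [hd y hy] at e4
    rw [max_eq_right hy1, ← pow_add, ← pow_add]
    refine ⟨?_, ?_, ?_⟩
    · have := le_mul_of_one_le_right (norm_nonneg (V y)) (one_le_pow₀ hy1 (n := K + 2))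
      linarith
    · rw [add_comm 2 K]
      linarith
    · have : ‖deriv V y‖ * y ^ (3 + K) = y ^ 1 * ‖deriv V y‖ * y ^ (K + 2) := by ring
      linarith

lemma rpow_neg_half_sub_le {x : ℝ} (hx : 0 < x) :
    |(x + 1) ^ (-(1 / 2 : ℝ)) - x ^ (-(1 / 2 : ℝ))| ≤ x ^ (-(1 / 2 : ℝ)) / x := by
  have hx1 : 0 < x + 1 := by linarith
  rw [Real.rpow_neg hx1.le, Real.rpow_neg hx.le, ← Real.sqrt_eq_rpow, ← Real.sqrt_eq_rpow]
  have h1 : √x ≤ √(x + 1) := Real.sqrt_le_sqrt (by linarith)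
  have h0 : 0 < √x := Real.sqrt_pos.2 hx
  have h2 : (√(x + 1))⁻¹ ≤ (√x)⁻¹ := inv_anti₀ h0 h1
  rw [abs_of_nonpos (by linarith), neg_sub, sub_le_iff_le_add]
  have hs : √x ^ 2 = x := Real.sq_sqrt hx.le
  have hs1 : √(x + 1) ^ 2 = x + 1 := Real.sq_sqrt hx1.le
  have h4 : 0 < √(x + 1) := h0.trans_le h1
  have h6 : (√(x + 1))⁻¹ = √(x + 1) / (x + 1) := by
    rw [eq_div_iff hx1.ne', inv_mul_eq_iff_eq_mul₀ h4.ne', ← sq, hs1]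
  have h7 : (√x)⁻¹ / x + √(x + 1) / (x + 1) - (√x)⁻¹ ≥ 0 := by
    have h8 : √x / (x + 1) ≤ √(x + 1) / (x + 1) := by gcongr
    have h9 : (√x)⁻¹ / x + √x / (x + 1) - (√x)⁻¹ = (√x)⁻¹ / (x * (x + 1)) := by
      have : √x = (√x)⁻¹ * x := by
        nth_rewrite 3 [← hs]
        field_simp
      rw [show √x / (x + 1) = (√x)⁻¹ * x / (x + 1) by rw [← this]]
      field_simp
      ring
    have h10 : 0 ≤ (√x)⁻¹ / (x * (x + 1)) := by positivity
    linarith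
  linarith

lemma Admissible.exists_norm_sub_le {V : ℝ → ℂ} (hV : Admissible V) (K : ℕ) :
    ∃ C : ℝ, 0 < C ∧ (∀ y : ℝ, 0 < y → ‖V y‖ ≤ C ∧ ‖V y‖ * (y ^ 2 * max 1 y ^ K) ≤ C) ∧
      ∀ x q : ℝ, 0 < x → 0 < q →
        ‖(((x + 1) ^ (-(1 / 2 : ℝ)) : ℝ) : ℂ) * V ((x + 1) / q) -
          ((x ^ (-(1 / 2 : ℝ)) : ℝ) : ℂ) * V (x / q)‖ *
          ((x / q) ^ 2 * max 1 (x / q) ^ K) ≤ C * (x ^ (-(1 / 2 : ℝ)) / x) := by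
  obtain ⟨C, hC, h⟩ := hV.exists_norm_le K
  refine ⟨2 * C, by positivity, fun y hy => ⟨by linarith [(h y hy).1],
    by linarith [(h y hy).2.1]⟩, fun x q hx hq => ?_⟩
  set y := x / q with hy
  have hy0 : 0 < y := by positivity
  have hyy : y ≤ (x + 1) / q := by rw [hy]; gcongr; linarith
  set W := y ^ 2 * max 1 y ^ K with hW
  have hW0 : 0 < W := by positivity
  have hxr : 0 < x ^ (-(1 / 2 : ℝ)) := Real.rpow_pos_of_pos hx _
  have hVn : ‖V ((x + 1) / q)‖ * W ≤ C := by
    refine le_trans ?_ (h ((x + 1) / q) (hy0.trans_le hyy)).2.1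
    rw [hW]
    gcongr
  have hder : ∀ z ∈ Set.Icc y ((x + 1) / q), ‖deriv V z‖ ≤ C / (y * W) := by
    intro z hz
    have hz0 : 0 < z := hy0.trans_le hz.1
    rw [le_div_iff₀ (by positivity)]
    refine le_trans ?_ (h z hz0).2.2
    have : y * W = y ^ 3 * max 1 y ^ K := by rw [hW]; ring
    rw [this]
    have := hz.1
    gcongr
  have hmvt : ‖V ((x + 1) / q) - V y‖ ≤ C / (y * W) * ‖(x + 1) / q - y‖ :=
    (convex_Icc y ((x + 1) / q)).norm_image_sub_le_of_norm_deriv_le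
      (fun z hz => hV.differentiableAt (hy0.trans_le hz.1)) hder
      (Set.left_mem_Icc.2 hyy) (Set.right_mem_Icc.2 hyy)
  have hdiff : ‖(x + 1) / q - y‖ = 1 / q := by
    rw [hy, ← sub_div, add_sub_cancel_left, Real.norm_of_nonneg (by positivity)]
  rw [hdiff] at hmvt
  have hmvt2 : ‖V ((x + 1) / q) - V y‖ * W ≤ C / x := by
    calc _ ≤ C / (y * W) * (1 / q) * W := by gcongr
      _ = C / x := by rw [hy]; field_simp
  have hdecomp : (((x + 1) ^ (-(1 / 2 : ℝ)) : ℝ) : ℂ) * V ((x + 1) / q) -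
      ((x ^ (-(1 / 2 : ℝ)) : ℝ) : ℂ) * V y =
      (((x + 1) ^ (-(1 / 2 : ℝ)) - x ^ (-(1 / 2 : ℝ)) : ℝ) : ℂ) * V ((x + 1) / q) +
      ((x ^ (-(1 / 2 : ℝ)) : ℝ) : ℂ) * (V ((x + 1) / q) - V y) := by
    push_cast
    ring
  rw [hdecomp]
  calc _ ≤ (|(x + 1) ^ (-(1 / 2 : ℝ)) - x ^ (-(1 / 2 : ℝ))| * ‖V ((x + 1) / q)‖ +
        x ^ (-(1 / 2 : ℝ)) * ‖V ((x + 1) / q) - V y‖) * W := by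
        gcongr
        refine (norm_add_le _ _).trans (le_of_eq ?_)
        rw [norm_mul, norm_mul, Complex.norm_real, Complex.norm_real, Real.norm_eq_abs,
          Real.norm_of_nonneg hxr.le]
    _ = |(x + 1) ^ (-(1 / 2 : ℝ)) - x ^ (-(1 / 2 : ℝ))| * (‖V ((x + 1) / q)‖ * W) +
        x ^ (-(1 / 2 : ℝ)) * (‖V ((x + 1) / q) - V y‖ * W) := by ring
    _ ≤ x ^ (-(1 / 2 : ℝ)) / x * C + x ^ (-(1 / 2 : ℝ)) * (C / x) := by
        gcongr
        exact rpow_neg_half_sub_le hx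
    _ = 2 * C * (x ^ (-(1 / 2 : ℝ)) / x) := by ring

/-- Partial sums of the twisted divisor sum. -/
lemma Admissible.exists_norm_partial_sum_le {V : ℝ → ℂ} (hV : Admissible V) :
    ∃ C : ℝ, 0 < C ∧ ∀ q : ℕ, q.Prime → ∀ ξ : ℤ, Int.gcd ξ q = 1 →
      ∀ᶠ n : ℕ in Filter.atTop, ‖∑ k ∈ Finset.range n,
        (if 1 ≤ k ∧ Nat.gcd k q = 1 then (k.divisors.card : ℂ) * unitExp (ξ * k ^ 2 / q) else 0) *
          ((((k : ℝ) ^ (-(1 / 2 : ℝ)) : ℝ) : ℂ) * V ((k : ℝ) / q))‖ ≤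
        C * (q : ℝ) ^ (1 / 2 - 1 / 1600 : ℝ) := by
  obtain ⟨C₁, hC₁, hD⟩ := exists_norm_sum_card_divisors_mul_unitExp_le
  obtain ⟨C₂, hC₂, hVle, hVd⟩ := hV.exists_norm_sub_le 43
  refine ⟨C₂ * (2 * 6401 ^ 2) + 4 * C₁ * C₂, by positivity, fun q hq ξ hξ => ?_⟩
  have hq0 : (0 : ℝ) < q := by exact_mod_cast hq.pos
  have hq1 : (1 : ℝ) ≤ q := by exact_mod_cast hq.one_le
  set f : ℕ → ℂ := fun k =>
    if 1 ≤ k ∧ Nat.gcd k q = 1 then (k.divisors.card : ℂ) * unitExp (ξ * k ^ 2 / q) else 0 with hf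
  set g : ℕ → ℂ := fun k => (((k : ℝ) ^ (-(1 / 2 : ℝ)) : ℝ) : ℂ) * V ((k : ℝ) / q) with hg
  set X : ℝ := (q : ℝ) ^ (399 / 400 : ℝ) with hX
  have hX0 : 0 < X := Real.rpow_pos_of_pos hq0 _
  have hX1 : 1 ≤ X := Real.one_le_rpow hq1 (by norm_num)
  have hXq : X ≤ q := by
    calc X ≤ (q : ℝ) ^ (1 : ℝ) := Real.rpow_le_rpow_of_exponent_le hq1 (by norm_num)
      _ = q := Real.rpow_one _
  set m := ⌈X⌉₊ with hm
  have hXm : X ≤ m := Nat.le_ceil X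
  have hm2 : (m : ℝ) ≤ 2 * X := by
    have := Nat.ceil_lt_add_one hX0.le
    linarith
  have hm1 : 1 ≤ m := Nat.one_le_iff_ne_zero.2 (Nat.ceil_pos.2 hX0).ne'
  have hm0 : (0 : ℝ) < m := by exact_mod_cast hm1
  set U : ℝ := (q : ℝ) ^ (79 / 80 : ℝ) with hU
  have hU0 : 0 < U := Real.rpow_pos_of_pos hq0 _
  set Z : ℝ := U * q ^ 2 * (X ^ (-(1 / 2 : ℝ)) / X ^ 2) with hZ
  have hZle : Z ≤ (q : ℝ) ^ (1 / 2 - 1 / 1600 : ℝ) := by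
    have : Z = (q : ℝ) ^ (1 / 2 - 1 / 160 : ℝ) := by
      rw [hZ, hU, hX, ← Real.rpow_mul hq0.le, ← Real.rpow_natCast _ 2, ← Real.rpow_natCast _ 2,
        ← Real.rpow_mul hq0.le, ← Real.rpow_sub hq0, ← Real.rpow_add hq0, ← Real.rpow_add hq0]
      norm_num
    rw [this]
    exact Real.rpow_le_rpow_of_exponent_le hq1 (by norm_num)
  have hgnorm : ∀ k : ℕ, ‖g k‖ = (k : ℝ) ^ (-(1 / 2 : ℝ)) * ‖V ((k : ℝ) / q)‖ := by
    intro k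
    simp only [hg]
    rw [norm_mul, Complex.norm_real, Real.norm_of_nonneg (by positivity)]
  have hT : ∀ k : ℕ, 1 ≤ k → ‖∑ j ∈ Finset.range (k + 1), f j‖ ≤
      C₁ * U * max 1 ((k : ℝ) / q) ^ 43 := by
    intro k hk
    refine le_of_eq_of_le (congrArg _ ?_) (hD q hq ξ hξ k hk)
    have hsub : Finset.Icc 1 k ⊆ Finset.range (k + 1) := fun j hj =>
      Finset.mem_range.2 (Nat.lt_succ_of_le (Finset.mem_Icc.1 hj).2)
    rw [← Finset.sum_subset hsub]
    · refine Finset.sum_congr rfl fun j hj => ?_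
      simp only [hf, (Finset.mem_Icc.1 hj).1, true_and]
      split_ifs <;> simp
    · intro j hj hj'
      have h1 := Finset.mem_range.1 hj
      have h2 : ¬ 1 ≤ j := fun h => hj' (Finset.mem_Icc.2 ⟨h, by omega⟩)
      simp [hf, h2]
  have hT' : ∀ k : ℕ, 1 ≤ k → ‖∑ j ∈ Finset.range k, f j‖ ≤
      C₁ * U * max 1 ((k : ℝ) / q) ^ 43 := by
    intro k hk
    obtain ⟨k, rfl⟩ : ∃ l, k = l + 1 := ⟨k - 1, by omega⟩
    rcases Nat.eq_zero_or_pos k with rfl | hk'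
    · simp [hf]
      positivity
    · refine (hT k hk').trans ?_
      gcongr
      simp
  have hbd : ∀ k : ℕ, m ≤ k → ‖(∑ j ∈ Finset.range k, f j) * g k‖ ≤ C₁ * C₂ * Z := by
    intro k hk
    have hXk : X ≤ k := hXm.trans (by exact_mod_cast hk)
    have hk0 : (0 : ℝ) < k := hX0.trans_le hXk
    have hrp : (k : ℝ) ^ (-(1 / 2 : ℝ)) ≤ X ^ (-(1 / 2 : ℝ)) :=
      Real.rpow_le_rpow_of_nonpos hX0 hXk (by norm_num)
    have h1 := (hVle ((k : ℝ) / q) (by positivity)).2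
    rw [norm_mul, hgnorm]
    calc _ ≤ C₁ * U * max 1 ((k : ℝ) / q) ^ 43 *
          ((k : ℝ) ^ (-(1 / 2 : ℝ)) * ‖V ((k : ℝ) / q)‖) := by
          gcongr
          exact hT' k (hm1.trans hk)
      _ = C₁ * U * q ^ 2 * ((k : ℝ) ^ (-(1 / 2 : ℝ)) / k ^ 2) *
          (‖V ((k : ℝ) / q)‖ * (((k : ℝ) / q) ^ 2 * max 1 ((k : ℝ) / q) ^ 43)) := by
          field_simp
      _ ≤ C₁ * U * q ^ 2 * (X ^ (-(1 / 2 : ℝ)) / X ^ 2) * C₂ := by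
          refine mul_le_mul (mul_le_mul_of_nonneg_left (div_le_div₀ (by positivity) hrp
            (by positivity) (by gcongr)) (by positivity)) h1 (by positivity) (by positivity)
      _ = C₁ * C₂ * Z := by rw [hZ]; ring
  have hstep : ∀ k : ℕ, m ≤ k → ‖(∑ j ∈ Finset.range (k + 1), f j) * (g (k + 1) - g k)‖ ≤
      C₁ * C₂ * Z * X * ((k : ℝ) ^ 2)⁻¹ := by
    intro k hk
    have hXk : X ≤ k := hXm.trans (by exact_mod_cast hk)
    have hk0 : (0 : ℝ) < k := hX0.trans_le hXk
    have hrp : (k : ℝ) ^ (-(1 / 2 : ℝ)) ≤ X ^ (-(1 / 2 : ℝ)) :=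
      Real.rpow_le_rpow_of_nonpos hX0 hXk (by norm_num)
    have h1 := hVd k q hk0 hq0
    have h2 : g (k + 1) - g k = ((((k : ℝ) + 1) ^ (-(1 / 2 : ℝ)) : ℝ) : ℂ) * V (((k : ℝ) + 1) / q) -
        (((k : ℝ) ^ (-(1 / 2 : ℝ)) : ℝ) : ℂ) * V ((k : ℝ) / q) := by
      simp only [hg, Nat.cast_add, Nat.cast_one]
    rw [← h2] at h1
    rw [norm_mul]
    calc _ ≤ C₁ * U * max 1 ((k : ℝ) / q) ^ 43 * ‖g (k + 1) - g k‖ := by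
          gcongr
          exact hT k (hm1.trans hk)
      _ = C₁ * U * q ^ 2 * ((k : ℝ) ^ 2)⁻¹ *
          (‖g (k + 1) - g k‖ * (((k : ℝ) / q) ^ 2 * max 1 ((k : ℝ) / q) ^ 43)) := by
          field_simp
      _ ≤ C₁ * U * q ^ 2 * ((k : ℝ) ^ 2)⁻¹ * (C₂ * ((k : ℝ) ^ (-(1 / 2 : ℝ)) / k)) := by gcongr
      _ ≤ C₁ * U * q ^ 2 * ((k : ℝ) ^ 2)⁻¹ * (C₂ * (X ^ (-(1 / 2 : ℝ)) / X)) := by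
          refine mul_le_mul_of_nonneg_left (mul_le_mul_of_nonneg_left (div_le_div₀
            (by positivity) hrp (by positivity) hXk) (by positivity)) (by positivity)
      _ = C₁ * C₂ * Z * X * ((k : ℝ) ^ 2)⁻¹ := by
          rw [hZ]
          field_simp
  have hshort : ‖∑ k ∈ Finset.range m, f k * g k‖ ≤
      C₂ * (2 * 6401 ^ 2) * (q : ℝ) ^ (1 / 2 - 1 / 1600 : ℝ) := by
    have h1 : ∀ k ∈ Finset.range m, ‖f k * g k‖ ≤
        C₂ * (if 1 ≤ k then (k.divisors.card : ℝ) * (k : ℝ) ^ (-(1 / 2 : ℝ)) else 0) := by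
      intro k hk
      rw [norm_mul, hgnorm]
      by_cases hk1 : 1 ≤ k
      · have hk0 : (0 : ℝ) < k := by exact_mod_cast hk1
        have h2 := (hVle ((k : ℝ) / q) (by positivity)).1
        have h3 : ‖f k‖ ≤ k.divisors.card := by
          simp only [hf]
          split_ifs
          · rw [norm_mul, norm_unitExp, Complex.norm_natCast, mul_one]
          · simp
        rw [if_pos hk1]
        calc _ ≤ (k.divisors.card : ℝ) * ((k : ℝ) ^ (-(1 / 2 : ℝ)) * C₂) := by gcongr
          _ = _ := by ring
      · simp [hf, hk1]
    refine (norm_sum_le_of_le _ h1).trans ?_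
    rw [← Finset.mul_sum, ← Finset.sum_filter, mul_assoc]
    refine mul_le_mul_of_nonneg_left ?_ hC₂.le
    have h2 : (Finset.range m).filter (1 ≤ ·) ⊆ Finset.Icc 1 m := by
      intro k hk
      simp only [Finset.mem_filter, Finset.mem_range] at hk
      exact Finset.mem_Icc.2 ⟨hk.2, hk.1.le⟩
    refine (Finset.sum_le_sum_of_subset_of_nonneg h2 fun _ _ _ => by positivity).trans ?_
    refine (sum_card_divisors_mul_rpow_le m).trans ?_
    have hsq : √(m : ℝ) ≤ 2 * (q : ℝ) ^ (399 / 800 : ℝ) := by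
      rw [Real.sqrt_le_left (by positivity), mul_pow, ← Real.rpow_natCast ((q : ℝ) ^ _),
        ← Real.rpow_mul hq0.le]
      norm_num
      rw [← hX]
      linarith
    have hlog : Real.log m ≤ 2 * Real.log q := by
      rw [← Real.log_rpow hq0, Real.rpow_two]
      have hq2 : (2 : ℝ) ≤ q := by exact_mod_cast hq.two_le
      exact Real.log_le_log hm0 (by nlinarith)
    have hlog2 : Real.log q ≤ 3200 * (q : ℝ) ^ (1 / 3200 : ℝ) := by
      have := Real.log_le_rpow_div hq0.le (show (0 : ℝ) < 1 / 3200 by norm_num)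
      rw [div_div_eq_mul_div, div_one] at this
      linarith
    have hone : 1 ≤ (q : ℝ) ^ (1 / 3200 : ℝ) := Real.one_le_rpow hq1 (by norm_num)
    have hlog0 : 0 ≤ Real.log m := Real.log_natCast_nonneg m
    calc √(m : ℝ) * (1 + Real.log m) ^ 2
        ≤ 2 * (q : ℝ) ^ (399 / 800 : ℝ) * (6401 * (q : ℝ) ^ (1 / 3200 : ℝ)) ^ 2 := by
          gcongr
          linarith
      _ = 2 * 6401 ^ 2 * ((q : ℝ) ^ (399 / 800 : ℝ) * ((q : ℝ) ^ (1 / 3200 : ℝ)) ^ 2) := by ring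
      _ = 2 * 6401 ^ 2 * (q : ℝ) ^ (1 / 2 - 1 / 1600 : ℝ) := by
          rw [← Real.rpow_natCast ((q : ℝ) ^ _), ← Real.rpow_mul hq0.le, ← Real.rpow_add hq0]
          norm_num
  filter_upwards [Filter.eventually_ge_atTop m] with n hn
  have hZ0 : 0 ≤ Z := by positivity
  have hlong : ‖∑ k ∈ Finset.Ico m n, f k * g k‖ ≤ 4 * C₁ * C₂ * Z := by
    rw [sum_Ico_mul_eq_sub f g hn]
    have h1 : ‖∑ k ∈ Finset.Ico m n, (∑ j ∈ Finset.range (k + 1), f j) * (g (k + 1) - g k)‖ ≤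
        C₁ * C₂ * Z * X * (2 / m) := by
      refine (norm_sum_le_of_le _ fun k hk => hstep k (Finset.mem_Ico.1 hk).1).trans ?_
      rw [← Finset.mul_sum]
      refine mul_le_mul_of_nonneg_left ?_ (by positivity)
      have h2 : Finset.Ico m n = Finset.Ioo (m - 1) n := by
        ext k
        simp only [Finset.mem_Ico, Finset.mem_Ioo]
        omega
      have h3 := sum_Ioo_inv_sq_le (α := ℝ) (m - 1) n
      rw [Nat.cast_sub hm1, Nat.cast_one, sub_add_cancel] at h3
      rw [h2]
      exact h3
    have h4 : C₁ * C₂ * Z * X * (2 / m) ≤ 2 * (C₁ * C₂ * Z) := by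
      have h5 : X / m ≤ 1 := (div_le_one hm0).2 hXm
      calc C₁ * C₂ * Z * X * (2 / m) = 2 * (C₁ * C₂ * Z) * (X / m) := by ring
        _ ≤ 2 * (C₁ * C₂ * Z) * 1 := by gcongr
        _ = _ := mul_one _
    have h6 := norm_sub_le ((∑ k ∈ Finset.range n, f k) * g n -
      (∑ k ∈ Finset.range m, f k) * g m)
      (∑ k ∈ Finset.Ico m n, (∑ j ∈ Finset.range (k + 1), f j) * (g (k + 1) - g k))
    have h7 := norm_sub_le ((∑ k ∈ Finset.range n, f k) * g n)
      ((∑ k ∈ Finset.range m, f k) * g m)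
    have h8 := hbd n hn
    have h9 := hbd m le_rfl
    linarith
  rw [← Finset.sum_range_add_sum_Ico _ hn]
  refine (norm_add_le _ _).trans ?_
  rw [add_mul]
  refine add_le_add hshort (hlong.trans ?_)
  gcongr

/-- There exists `η > 0` such that for every admissible `V` there is `C > 0`
with: for every prime `q` and every `ξ` coprime to `q`,
`|q^{-1/2} Σ_{n ≥ 1, (n,q)=1} d(n) n^{-1/2} V(n/q) e^{2πi ξ n²/q}| ≤ C q^{-η}`. -/
theorem divisor_sum_with_additive_char_bound :
    ∃ η : ℝ, 0 < η ∧ ∀ V : ℝ → ℂ, Admissible V → ∃ C : ℝ, 0 < C ∧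
      ∀ q : ℕ, Nat.Prime q → ∀ ξ : ℤ, Int.gcd ξ q = 1 →
        ‖(Real.sqrt q : ℂ)⁻¹ *
            ∑' n : ℕ,
              if 1 ≤ n ∧ Nat.gcd n q = 1 then
                (n.divisors.card : ℂ) * (((n : ℝ) ^ (-(1 / 2 : ℝ)) : ℝ) : ℂ) *
                  V ((n : ℝ) / q) *
                  Complex.exp (2 * Real.pi * Complex.I * (ξ : ℂ) * (n : ℂ) ^ 2 / q)
              else 0‖ ≤ C * (q : ℝ) ^ (-η) := by
  refine ⟨1 / 1600, by norm_num, fun V hV => ?_⟩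
  obtain ⟨C, hC, h⟩ := hV.exists_norm_partial_sum_le
  refine ⟨C, hC, fun q hq ξ hξ => ?_⟩
  have hq0 : (0 : ℝ) < q := by exact_mod_cast hq.pos
  have hpart := h q hq ξ hξ
  set F : ℕ → ℂ := fun n => if 1 ≤ n ∧ Nat.gcd n q = 1 then
    (n.divisors.card : ℂ) * (((n : ℝ) ^ (-(1 / 2 : ℝ)) : ℝ) : ℂ) * V ((n : ℝ) / q) *
      Complex.exp (2 * Real.pi * Complex.I * (ξ : ℂ) * (n : ℂ) ^ 2 / q) else 0 with hF
  have hterm : ∀ k : ℕ, (if 1 ≤ k ∧ Nat.gcd k q = 1 then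
      (k.divisors.card : ℂ) * unitExp (ξ * k ^ 2 / q) else 0) *
      ((((k : ℝ) ^ (-(1 / 2 : ℝ)) : ℝ) : ℂ) * V ((k : ℝ) / q)) = F k := by
    intro k
    simp only [hF]
    split_ifs
    · have : unitExp (ξ * k ^ 2 / q) =
          Complex.exp (2 * Real.pi * Complex.I * (ξ : ℂ) * (k : ℂ) ^ 2 / q) := by
        rw [unitExp]
        congr 1
        push_cast
        ring
      rw [this]
      ring
    · rw [zero_mul]
  simp_rw [hterm] at hpart
  have htsum : ‖∑' n, F n‖ ≤ C * (q : ℝ) ^ (1 / 2 - 1 / 1600 : ℝ) := by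
    by_cases hs : Summable F
    · exact le_of_tendsto hs.hasSum.tendsto_sum_nat.norm hpart
    · rw [tsum_eq_zero_of_not_summable hs, norm_zero]
      positivity
  have hsqrt : ‖((Real.sqrt q : ℝ) : ℂ)⁻¹‖ = (q : ℝ) ^ (-(1 / 2) : ℝ) := by
    rw [norm_inv, Complex.norm_real, Real.norm_of_nonneg (Real.sqrt_nonneg _),
      Real.sqrt_eq_rpow, Real.rpow_neg hq0.le]
  rw [norm_mul, hsqrt]
  calc _ ≤ (q : ℝ) ^ (-(1 / 2) : ℝ) * (C * (q : ℝ) ^ (1 / 2 - 1 / 1600 : ℝ)) := by gcongr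
    _ = C * ((q : ℝ) ^ (-(1 / 2) : ℝ) * (q : ℝ) ^ (1 / 2 - 1 / 1600 : ℝ)) := by ring
    _ = C * (q : ℝ) ^ (-(1 / 1600) : ℝ) := by
      rw [← Real.rpow_add hq0]
      norm_num
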